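/- arXiv:1411.7400 — 2 statements merged into one kernel-verified Lean document; each statement's English description precedes it below -/
import Mathlib

section
/- Let 0 < q < 1 (or more generally q ≠ 0, 1), let n ≥ 1, and let A(x) = (a_{ij}(x))_{1≤i,j≤n} be an n×n matrix whose entries are real-valued functions of a real variable x. Then for every x ≠ 0 the q-derivative of the determinant satisfies D_q(det A)(x) = ∑_{i=1}^n det A^{(i)}(x), where A^{(i)}(x) is the n×n matrix whose rows 1,…,i−1 have entries a_{kj}(qx), whose row i has entries D_q(a_{ij})(x), and whose rows i+1,…,n have entries a_{kj}(x). -/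
/-- The `q`-derivative of `f` at `x`: `D_q f(x) = (f(qx) - f(x))/(qx - x)`. -/
noncomputable def qDeriv (q : ℝ) (f : ℝ → ℝ) (x : ℝ) : ℝ := (f (q * x) - f x) / (q * x - x)

/-- Replacing the rows of `C` by those of `B` one at a time, from the top, telescopes the
difference of the determinants. -/
theorem Matrix.det_sub_det_eq_sum_updateRow {R : Type*} [CommRing R] {n : ℕ}
    (B C : Matrix (Fin n) (Fin n) R) :
    B.det - C.det = ∑ i : Fin n,
      ((Matrix.of fun k j => if k < i then B k j else C k j).updateRow i (B i - C i)).det := by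
  let M : ℕ → Matrix (Fin n) (Fin n) R := fun m =>
    Matrix.of fun k j => if (k : ℕ) < m then B k j else C k j
  have h_step (i : Fin n) :
      ((Matrix.of fun k j => if k < i then B k j else C k j).updateRow i (B i - C i)).det
        = (M (i + 1)).det - (M i).det := by
    have h_succ : M (i + 1) = (M i).updateRow i (B i) := by
      ext k j
      by_cases hk : k = i
      · subst hk
        simp [M]
      · have h_iff : (k : ℕ) < i + 1 ↔ (k : ℕ) < i := by
          have := Fin.val_ne_of_ne hk
          omega
        simp [M, hk, h_iff]
    have h_self : M i = (M i).updateRow i (C i) := by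
      ext k j
      by_cases hk : k = i
      · subst hk
        simp [M]
      · simp [hk]
    have h_add := Matrix.det_updateRow_add (M i) i (B i - C i) (C i)
    rw [sub_add_cancel, ← h_succ, ← h_self] at h_add
    exact eq_sub_of_add_eq h_add.symm
  have h_zero : M 0 = C := by ext; simp [M]
  have h_last : M n = B := by ext; simp [M]
  simp_rw [h_step]
  rw [Fin.sum_univ_eq_sum_range fun m => (M (m + 1)).det - (M m).det,
    Finset.sum_range_sub fun m => (M m).det, h_zero, h_last]

/-- Lemma 1: for an `n × n` matrix of functions, the `q`-derivative of the determinant is the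
sum over `i` of the determinants of the matrices whose rows `< i` are evaluated at `qx`,
whose row `i` is `q`-differentiated, and whose rows `> i` are evaluated at `x`. -/
theorem qDeriv_det (q : ℝ) (hq0 : q ≠ 0) (hq1 : q ≠ 1) (n : ℕ) (hn : 1 ≤ n)
    (A : Fin n → Fin n → ℝ → ℝ) (x : ℝ) (hx : x ≠ 0) :
    qDeriv q (fun y => (Matrix.of fun i j => A i j y).det) x
      = ∑ i : Fin n,
          (Matrix.of fun k j =>
            if k < i then A k j (q * x)
            else if k = i then qDeriv q (A k j) x
            else A k j x).det := by
  rw [qDeriv, Matrix.det_sub_det_eq_sum_updateRow, Finset.sum_div]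
  refine Finset.sum_congr rfl fun i _ => ?_
  rw [div_eq_inv_mul, ← Matrix.det_updateRow_smul]
  congr 1
  ext k j
  by_cases hk : k = i
  · subst hk
    simp [qDeriv, div_eq_inv_mul]
  · simp [hk]
end

section
/- Fix q with 0 < q < 1 and real numbers β_0 ≠ 0, β_1, β_2, …. For n ≥ 1, every x ∈ ℝ satisfies P_{n,q}(qx) − P_{n,q}(x) = (qx − x)·[n]_q·P_{n−1,q}(x); that is, the determinantally defined polynomials P_{n,q} satisfy the q-Appell relation D_q P_{n,q} = [n]_q P_{n−1,q}. -/
/-- The `q`-number `[n]_q = (1 - q^n)/(1 - q)`. -/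
noncomputable def qNum (q : ℝ) (n : ℕ) : ℝ := (1 - q ^ n) / (1 - q)

/-- The `q`-factorial `[n]_q! = [1]_q [2]_q ⋯ [n]_q`. -/
noncomputable def qFact (q : ℝ) : ℕ → ℝ
  | 0 => 1
  | n + 1 => qFact q n * qNum q (n + 1)

/-- The `q`-binomial coefficient `[n choose k]_q = [n]_q!/([k]_q! [n-k]_q!)`. -/
noncomputable def qBinom (q : ℝ) (n k : ℕ) : ℝ := qFact q n / (qFact q k * qFact q (n - k))

/-- The `(n+1) × (n+1)` matrix `M_n(x)` whose row `0` is `1, x, x², …, xⁿ` and whose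
row `i` (for `1 ≤ i ≤ n`) has entries `[j choose i-1]_q · β_{j-i+1}` when `j ≥ i - 1`
and `0` otherwise. -/
noncomputable def detMat (q : ℝ) (β : ℕ → ℝ) (x : ℝ) (n : ℕ) :
    Matrix (Fin (n + 1)) (Fin (n + 1)) ℝ :=
  Matrix.of fun i j =>
    if (i : ℕ) = 0 then x ^ (j : ℕ)
    else if (i : ℕ) ≤ (j : ℕ) + 1 then
      qBinom q (j : ℕ) ((i : ℕ) - 1) * β ((j : ℕ) + 1 - (i : ℕ))
    else 0

/-- The determinantally defined `q`-polynomials: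
`P_{0,q}(x) = 1/β₀` and `P_{n,q}(x) = ((-1)ⁿ/β₀^{n+1}) · det M_n(x)` for `n ≥ 1`. -/
noncomputable def detP (q : ℝ) (β : ℕ → ℝ) : ℕ → ℝ → ℝ
  | 0, _ => 1 / β 0
  | n + 1, x => ((-1) ^ (n + 1) / (β 0) ^ (n + 2)) * (detMat q β x (n + 1)).det

theorem qNum_succ_ne_zero {q : ℝ} (hq0 : 0 < q) (hq1 : q < 1) (n : ℕ) : qNum q (n + 1) ≠ 0 := by
  have h : q ^ (n + 1) < 1 := pow_lt_one₀ hq0.le hq1 (Nat.succ_ne_zero n)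
  exact div_ne_zero (sub_ne_zero.2 h.ne') (sub_ne_zero.2 hq1.ne')

theorem qFact_ne_zero {q : ℝ} (hq0 : 0 < q) (hq1 : q < 1) (n : ℕ) : qFact q n ≠ 0 := by
  induction n with
  | zero => exact one_ne_zero
  | succ n ih => exact mul_ne_zero ih (qNum_succ_ne_zero hq0 hq1 n)

/-- The absorption identity `[n+1 choose k+1]_q = [n+1]_q / [k+1]_q · [n choose k]_q`. -/
theorem qBinom_succ_succ {q : ℝ} (n k : ℕ) :
    qBinom q (n + 1) (k + 1) = (qNum q (k + 1))⁻¹ * (qNum q (n + 1) * qBinom q n k) := by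
  simp only [qBinom, qFact, Nat.add_sub_add_right, div_eq_mul_inv, mul_inv]
  ring

theorem qBinom_zero_right {q : ℝ} (hq0 : 0 < q) (hq1 : q < 1) (n : ℕ) : qBinom q n 0 = 1 := by
  simp [qBinom, qFact, div_self (qFact_ne_zero hq0 hq1 n)]

/-- The `q`-difference of a monomial. -/
theorem mul_pow_sub_pow_eq_qNum {q : ℝ} (hq1 : q < 1) (x : ℝ) (j : ℕ) :
    (q * x) ^ j - x ^ j = (q * x - x) * (qNum q j * x ^ (j - 1)) := by
  have h : 1 - q ≠ 0 := sub_ne_zero.2 hq1.ne'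
  cases j with
  | zero => simp [qNum]
  | succ j =>
    rw [qNum, Nat.add_sub_cancel]
    field_simp
    ring

/-- The matrix `M_n(x)` with its first row replaced by the `q`-derivatives
`[j]_q x^{j-1}` of the monomials. -/
noncomputable def derivMat (q : ℝ) (β : ℕ → ℝ) (x : ℝ) (n : ℕ) :
    Matrix (Fin (n + 1)) (Fin (n + 1)) ℝ :=
  (detMat q β x n).updateRow 0 fun j => qNum q j * x ^ ((j : ℕ) - 1)

theorem det_detMat_sub {q : ℝ} (hq1 : q < 1) (β : ℕ → ℝ) (x : ℝ) (n : ℕ) :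
    (detMat q β (q * x) n).det - (detMat q β x n).det =
      (q * x - x) * (derivMat q β x n).det := by
  have hrow (y : ℝ) : detMat q β y n =
      (detMat q β x n).updateRow 0 fun j => y ^ (j : ℕ) := by
    ext i j
    by_cases hi : i = 0
    · subst hi; simp [detMat]
    · simp [detMat, hi]
  rw [derivMat, ← Matrix.det_updateRow_smul, sub_eq_iff_eq_add', hrow (q * x)]
  conv_rhs => enter [1]; rw [hrow x]
  rw [← Matrix.det_updateRow_add]
  congr 2
  ext j
  simp [← mul_pow_sub_pow_eq_qNum hq1]

theorem prod_qNum_ratio {q : ℝ} (hq0 : 0 < q) (hq1 : q < 1) (m : ℕ) :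
    (∏ i : Fin (m + 1), if (i : ℕ) = 0 then 1 else (qNum q i)⁻¹) *
      ∏ j : Fin (m + 1), qNum q (j + 1) = qNum q (m + 1) := by
  have h : ∏ i : Fin m, qNum q (i + 1) ≠ 0 :=
    Finset.prod_ne_zero_iff.2 fun i _ => qNum_succ_ne_zero hq0 hq1 i
  rw [Fin.prod_univ_succ, Fin.prod_univ_castSucc]
  simp [h]

theorem submatrix_derivMat (q : ℝ) (β : ℕ → ℝ) (x : ℝ) (m : ℕ) :
    (derivMat q β x (m + 1)).submatrix (Fin.succAbove 1) Fin.succ =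
      Matrix.of fun i j : Fin (m + 1) => (if (i : ℕ) = 0 then 1 else (qNum q i)⁻¹) *
        Matrix.of (fun i j : Fin (m + 1) => qNum q (j + 1) * detMat q β x m i j) i j := by
  ext i j
  refine Fin.cases ?_ (fun k => ?_) i
  · simp [derivMat, detMat]
  · have h : Fin.succAbove (1 : Fin (m + 2)) k.succ = k.succ.succ := by
      rw [← Fin.succ_zero_eq_one, Fin.succ_succAbove_succ, Fin.succAbove_zero]
    simp only [Matrix.submatrix_apply, h, derivMat, Matrix.updateRow_ne (Fin.succ_ne_zero _),
      detMat, Matrix.of_apply, Fin.val_succ, Nat.add_sub_cancel, Nat.succ_ne_zero, if_false,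
      Nat.add_le_add_iff_right, qBinom_succ_succ, Nat.add_sub_add_right]
    split_ifs <;> ring

theorem det_derivMat {q : ℝ} (hq0 : 0 < q) (hq1 : q < 1) (β : ℕ → ℝ) (x : ℝ) (m : ℕ) :
    (derivMat q β x (m + 1)).det = -β 0 * qNum q (m + 1) * (detMat q β x m).det := by
  rw [Matrix.det_succ_column_zero, Finset.sum_eq_single 1]
  · rw [submatrix_derivMat, Matrix.det_mul_column, Matrix.det_mul_row, ← mul_assoc (Finset.prod _ _),
      prod_qNum_ratio hq0 hq1]
    have h : derivMat q β x (m + 1) 1 0 = β 0 := by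
      simp [derivMat, detMat, qBinom_zero_right hq0 hq1]
    simp [h, mul_assoc]
  · intro i _ hi
    have h : derivMat q β x (m + 1) i 0 = 0 := by
      by_cases h0 : i = 0
      · subst h0; simp [derivMat, qNum]
      · have h1 : (i : ℕ) ≠ 0 := fun h => h0 (Fin.ext h)
        have h2 : (i : ℕ) ≠ 1 := fun h => hi (Fin.ext (by simpa using h))
        have h3 : ¬ (i : ℕ) ≤ 1 := by omega
        simp [derivMat, detMat, h0, h3]
    simp [h]
  · simp

theorem detP_eq (q : ℝ) (β : ℕ → ℝ) (n : ℕ) (x : ℝ) :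
    detP q β n x = (-1) ^ n / β 0 ^ (n + 1) * (detMat q β x n).det := by
  cases n with
  | zero => simp [detP, detMat]
  | succ n => rfl

/-- Theorem: the determinantally defined polynomials satisfy the `q`-Appell relation
`D_q P_{n,q} = [n]_q P_{n-1,q}`, i.e.
`P_{n,q}(qx) - P_{n,q}(x) = (qx - x)·[n]_q·P_{n-1,q}(x)` for `n ≥ 1`. -/
theorem detP_qAppell (q : ℝ) (hq0 : 0 < q) (hq1 : q < 1) (β : ℕ → ℝ) (hβ : β 0 ≠ 0) :
    ∀ n : ℕ, 1 ≤ n → ∀ x : ℝ,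
      detP q β n (q * x) - detP q β n x = (q * x - x) * qNum q n * detP q β (n - 1) x := by
  intro n hn x
  obtain ⟨m, rfl⟩ := Nat.exists_eq_add_of_le' hn
  rw [Nat.add_sub_cancel, detP_eq, detP_eq, detP_eq, ← mul_sub, det_detMat_sub hq1,
    det_derivMat hq0 hq1]
  field_simp
  ring
end
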